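/- arXiv:2412.15987 — 3 statements merged into one kernel-verified Lean document; each statement's English description precedes it below -/
import Mathlib

section
/- There is no 3-dimensional linear subspace V of sl₃(ℂ) such that all pairs of elements of V commute; i.e., every abelian linear subspace of sl₃(ℂ) has dimension at most 2. -/
open Matrix

/-- A commuting set of endomorphisms of a nonzero finite-dimensional space over an algebraically
closed field has a common eigenvector. -/
theorem exists_common_eigenvector_of_commute {K E : Type*} [Field K] [IsAlgClosed K]
    [AddCommGroup E] [Module K E] [FiniteDimensional K E] [Nontrivial E]
    (S : Set (Module.End K E)) (hS : ∀ f ∈ S, ∀ g ∈ S, Commute f g) :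
    ∃ v : E, v ≠ 0 ∧ ∀ f ∈ S, ∃ μ : K, f v = μ • v := by
  obtain ⟨W, ⟨hW0, hWS⟩, hmin⟩ := wellFounded_lt.has_min
    {W : Submodule K E | W ≠ ⊥ ∧ ∀ f ∈ S, ∀ x ∈ W, f x ∈ W} ⟨⊤, top_ne_bot, by simp⟩
  obtain ⟨v, hvW, hv0⟩ := Submodule.exists_mem_ne_zero_of_ne_bot hW0
  refine ⟨v, hv0, fun f hf ↦ ?_⟩
  have : Nontrivial W := Submodule.nontrivial_iff_ne_bot.mpr hW0
  obtain ⟨μ, hμ⟩ := Module.End.exists_eigenvalue (f.restrict (hWS f hf))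
  obtain ⟨w, hw⟩ := hμ.exists_hasEigenvector
  have hfw : f w = μ • (w : E) := by simpa using congrArg Subtype.val hw.apply_eq_smul
  let U : Submodule K E := W ⊓ f.eigenspace μ
  have hU : U ≠ ⊥ := by
    refine (Submodule.ne_bot_iff _).mpr ⟨w, ⟨w.2, ?_⟩, by simpa using hw.2⟩
    exact Module.End.mem_eigenspace_iff.mpr hfw
  have hUS : ∀ g ∈ S, ∀ x ∈ U, g x ∈ U := by
    rintro g hg x ⟨hxW, hx⟩
    refine ⟨hWS g hg x hxW, Module.End.mem_eigenspace_iff.mpr ?_⟩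
    have hfg : f (g x) = g (f x) := LinearMap.congr_fun (hS f hf g hg).eq x
    rw [hfg, Module.End.mem_eigenspace_iff.mp hx, map_smul]
  have hUW : U = W := by
    by_contra h
    exact hmin U ⟨hU, hUS⟩ (lt_of_le_of_ne inf_le_left h)
  have hvU : v ∈ U := hUW ▸ hvW
  exact ⟨μ, Module.End.mem_eigenspace_iff.mp hvU.2⟩

/-- A space on which two linear functionals have no common nontrivial zero has dimension at
most two. -/
theorem finrank_le_two_of_two_functionals {K M : Type*} [Field K] [AddCommGroup M] [Module K M]
    (f g : M →ₗ[K] K) (h : ∀ x, f x = 0 → g x = 0 → x = 0) : Module.finrank K M ≤ 2 := by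
  have hinj : Function.Injective (f.prod g) := by
    rw [injective_iff_map_eq_zero]
    intro x hx
    obtain ⟨h₁, h₂⟩ := Prod.ext_iff.mp hx
    exact h x h₁ h₂
  simpa using LinearMap.finrank_le_finrank_of_injective hinj

/-- Pairwise proportional functionals are controlled by a single one of them. -/
theorem exists_functional_of_proportional {ι K M : Type*} [Field K] [AddCommGroup M] [Module K M]
    (f : ι → M →ₗ[K] K) (h : ∀ i j x y, f i x * f j y = f i y * f j x) :
    ∃ k : M →ₗ[K] K, ∀ x, k x = 0 → ∀ i, f i x = 0 := by
  by_cases h0 : ∀ i x, f i x = 0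
  · exact ⟨0, fun x _ i ↦ h0 i x⟩
  · push Not at h0
    obtain ⟨i, y, hy⟩ := h0
    refine ⟨f i, fun x hx j ↦ ?_⟩
    have := h i j x y
    rw [hx, zero_mul] at this
    exact (mul_eq_zero.mp this.symm).resolve_left hy

/-- Abelian spaces of traceless matrices with the first standard basis vector as a common eigenvector
have dimension at most two. -/
theorem finrank_le_two_of_first_column {K : Type*} [Field K] [CharZero K]
    (V : Submodule K (Matrix (Fin 3) (Fin 3) K))
    (htr : ∀ A ∈ V, A.trace = 0) (hab : ∀ A ∈ V, ∀ B ∈ V, A * B = B * A)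
    (h₁ : ∀ A ∈ V, A 1 0 = 0) (h₂ : ∀ A ∈ V, A 2 0 = 0) : Module.finrank K V ≤ 2 := by
  obtain ⟨e, he⟩ : ∃ e : Fin 3 → Fin 3 → V →ₗ[K] K,
      ∀ i j (A : V), e i j A = (A : Matrix (Fin 3) (Fin 3) K) i j :=
    ⟨fun i j ↦ Matrix.entryLinearMap K K i j ∘ₗ V.subtype, fun _ _ _ ↦ rfl⟩
  have e10 (A : V) : e 1 0 A = 0 := (he 1 0 A).trans (h₁ A A.2)
  have e20 (A : V) : e 2 0 A = 0 := (he 2 0 A).trans (h₂ A A.2)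
  have tr (A : V) : e 0 0 A + e 1 1 A + e 2 2 A = 0 := by
    simpa [he, Matrix.trace, Fin.sum_univ_three] using htr A A.2
  have comm (i j : Fin 3) (A B : V) :
      e i 0 A * e 0 j B + e i 1 A * e 1 j B + e i 2 A * e 2 j B =
        e i 0 B * e 0 j A + e i 1 B * e 1 j A + e i 2 B * e 2 j A := by
    simpa [he, Matrix.mul_apply, Fin.sum_univ_three] using congr_fun₂ (hab A A.2 B B.2) i j
  have eq_zero (A : V) (h00 : e 0 0 A = 0) (h01 : e 0 1 A = 0) (h02 : e 0 2 A = 0)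
      (h11 : e 1 1 A = 0) (h12 : e 1 2 A = 0) (h21 : e 2 1 A = 0) (h22 : e 2 2 A = 0) :
      A = 0 := by
    have hA : ∀ i j, e i j A = 0 := by
      simp only [Fin.forall_fin_succ, IsEmpty.forall_iff, and_true]
      exact ⟨⟨h00, h01, h02⟩, ⟨e10 A, h11, h12⟩, ⟨e20 A, h21, h22⟩⟩
    exact Subtype.ext (Matrix.ext fun i j ↦ (he i j A).symm.trans (hA i j))
  have prop (i j : Fin 3) (A B : V) :
      ![e 1 1 - e 2 2, e 1 2, e 2 1] i A * ![e 1 1 - e 2 2, e 1 2, e 2 1] j B =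
        ![e 1 1 - e 2 2, e 1 2, e 2 1] i B * ![e 1 1 - e 2 2, e 1 2, e 2 1] j A := by
    have c11 := comm 1 1 A B
    have c12 := comm 1 2 A B
    have c21 := comm 2 1 A B
    simp only [e10, e20] at c11 c12 c21
    fin_cases i <;> fin_cases j <;> simp <;> grind
  obtain ⟨k, hk⟩ := exists_functional_of_proportional _ prop
  have hk (A : V) (hA : k A = 0) : e 1 1 A = e 2 2 A ∧ e 1 2 A = 0 ∧ e 2 1 A = 0 := by
    have h := hk A hA
    exact ⟨by simpa [sub_eq_zero] using h 0, by simpa using h 1, by simpa using h 2⟩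
  by_cases hrow : ∃ A : V, A ≠ 0 ∧ k A = 0 ∧ e 0 0 A = 0
  swap
  · push Not at hrow
    refine finrank_le_two_of_two_functionals k (e 0 0) fun A h h' ↦ ?_
    by_contra h0
    exact hrow A h0 h h'
  obtain ⟨A, hA0, hkA, hA00⟩ := hrow
  have block (B : V) (hkB : k B = 0) (hB : e 0 0 B = 0) :
      e 1 1 B = 0 ∧ e 1 2 B = 0 ∧ e 2 1 B = 0 ∧ e 2 2 B = 0 := by
    obtain ⟨h, h12, h21⟩ := hk B hkB
    have ht := tr B
    rw [hB, h, zero_add, add_self_eq_zero] at ht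
    exact ⟨h.trans ht, h12, h21, ht⟩
  have ext_zero (B : V) (hkB : k B = 0) (hB : e 0 0 B = 0) (hB1 : e 0 1 B = 0)
      (hB2 : e 0 2 B = 0) : B = 0 := by
    obtain ⟨h11, h12, h21, h22⟩ := block B hkB hB
    exact eq_zero B hB hB1 hB2 h11 h12 h21 h22
  have row (B : V) (hkB : k B = 0) (hB : e 0 0 B = 0) (C : V) :
      e 0 1 B * e 1 1 C + e 0 2 B * e 2 1 C = e 0 0 C * e 0 1 B ∧
      e 0 1 B * e 1 2 C + e 0 2 B * e 2 2 C = e 0 0 C * e 0 2 B := by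
    obtain ⟨h11, h12, h21, h22⟩ := block B hkB hB
    have c1 := comm 0 1 B C
    have c2 := comm 0 2 B C
    simp only [hB, h11, h12, h21, h22] at c1 c2
    exact ⟨by linear_combination c1, by linear_combination c2⟩
  by_cases hind : ∃ B C : V, (k B = 0 ∧ e 0 0 B = 0) ∧ (k C = 0 ∧ e 0 0 C = 0) ∧
      e 0 1 B * e 0 2 C - e 0 1 C * e 0 2 B ≠ 0
  · obtain ⟨B, C, ⟨hkB, hB⟩, ⟨hkC, hC⟩, hBC⟩ := hind
    refine finrank_le_two_of_two_functionals (e 0 1) (e 0 2) fun D h h' ↦ ?_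
    obtain ⟨b1, b2⟩ := row B hkB hB D
    obtain ⟨c1, c2⟩ := row C hkC hC D
    have d11 : e 1 1 D = e 0 0 D := mul_left_cancel₀ hBC (by
      linear_combination e 0 2 C * b1 - e 0 2 B * c1)
    have d21 : e 2 1 D = 0 := mul_left_cancel₀ hBC (by
      linear_combination e 0 1 B * c1 - e 0 1 C * b1)
    have d12 : e 1 2 D = 0 := mul_left_cancel₀ hBC (by
      linear_combination e 0 2 C * b2 - e 0 2 B * c2)
    have d22 : e 2 2 D = e 0 0 D := mul_left_cancel₀ hBC (by
      linear_combination e 0 1 B * c2 - e 0 1 C * b2)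
    have d00 : e 0 0 D = 0 := by grind
    exact eq_zero D d00 h h' (d11.trans d00) d12 d21 (d22.trans d00)
  · push Not at hind
    have scalar (C : V) (hkC : k C = 0) : e 0 0 C = 0 := by
      obtain ⟨h, h12, h21⟩ := hk C hkC
      obtain ⟨a1, a2⟩ := row A hkA hA00 C
      by_contra h0
      have hne : e 2 2 C - e 0 0 C ≠ 0 := fun h' ↦ h0 (by grind)
      refine hA0 (ext_zero A hkA hA00 (mul_left_cancel₀ hne ?_) (mul_left_cancel₀ hne ?_))
      · rw [h, h21] at a1
        linear_combination a1
      · rw [h12] at a2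
        linear_combination a2
    by_cases hA1 : e 0 1 A = 0
    · have hA2 : e 0 2 A ≠ 0 := fun h ↦ hA0 (ext_zero A hkA hA00 hA1 h)
      refine finrank_le_two_of_two_functionals k (e 0 2) fun C hkC hC ↦ ?_
      have hC0 := scalar C hkC
      have := hind C A ⟨hkC, hC0⟩ ⟨hkA, hA00⟩
      rw [hA1, zero_mul, sub_zero] at this
      exact ext_zero C hkC hC0 ((mul_eq_zero.mp this).resolve_right hA2) hC
    · refine finrank_le_two_of_two_functionals k (e 0 1) fun C hkC hC ↦ ?_
      have hC0 := scalar C hkC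
      have := hind A C ⟨hkA, hA00⟩ ⟨hkC, hC0⟩
      rw [hC, zero_mul, sub_zero] at this
      exact ext_zero C hkC hC0 hC ((mul_eq_zero.mp this).resolve_left hA1)

/-- Every abelian linear subspace of `sl₃(ℂ)` (traceless 3×3 complex matrices)
has dimension at most 2. -/
theorem no_abelian_three_plane_in_sl3
    (V : Submodule ℂ (Matrix (Fin 3) (Fin 3) ℂ))
    (htr : ∀ A ∈ V, Matrix.trace A = 0)
    (hab : ∀ A ∈ V, ∀ B ∈ V, A * B = B * A) :
    Module.finrank ℂ V ≤ 2 := by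
  obtain ⟨v, hv0, hv⟩ := exists_common_eigenvector_of_commute
    (Matrix.toLinAlgEquiv' '' (V : Set (Matrix (Fin 3) (Fin 3) ℂ))) (by
      rintro _ ⟨A, hA, rfl⟩ _ ⟨B, hB, rfl⟩
      rw [commute_iff_eq, ← map_mul, ← map_mul, hab A hA B hB])
  obtain ⟨b, hb⟩ : ∃ b : Module.Basis (Fin 3) ℂ (Fin 3 → ℂ), b 0 = v := by
    obtain ⟨g, hg⟩ := SeparatingDual.exists_continuousLinearEquiv_apply_eq (R := ℂ)
      (Pi.single_ne_zero_iff.mpr one_ne_zero : (Pi.single 0 1 : Fin 3 → ℂ) ≠ 0) hv0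
    exact ⟨(Pi.basisFun ℂ (Fin 3)).map g.toLinearEquiv, by simpa using hg⟩
  let φ : Matrix (Fin 3) (Fin 3) ℂ ≃ₐ[ℂ] Matrix (Fin 3) (Fin 3) ℂ :=
    Matrix.toLinAlgEquiv'.trans (LinearMap.toMatrixAlgEquiv b)
  have hcol (i : Fin 3) (hi : i ≠ 0) (A : Matrix (Fin 3) (Fin 3) ℂ) (hA : A ∈ V) :
      φ A i 0 = 0 := by
    obtain ⟨μ, hμ⟩ := hv _ ⟨A, hA, rfl⟩
    have : φ A i 0 = b.repr (Matrix.toLinAlgEquiv' A (b 0)) i :=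
      LinearMap.toMatrixAlgEquiv_apply b _ i 0
    rw [this, hb, hμ, ← hb]
    simp [hi.symm]
  rw [(φ.toLinearEquiv.submoduleMap V).finrank_eq]
  apply finrank_le_two_of_first_column
  · rintro _ ⟨A, hA, rfl⟩
    rw [← htr A hA]
    have : (φ A).trace = LinearMap.trace ℂ _ (Matrix.toLin' A) :=
      (LinearMap.trace_eq_matrix_trace ℂ b (Matrix.toLin' A)).symm
    exact this.trans (Matrix.trace_toLin'_eq A)
  · rintro _ ⟨A, hA, rfl⟩ _ ⟨B, hB, rfl⟩
    change φ A * φ B = φ B * φ A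
    rw [← map_mul, hab A hA B hB, map_mul]
  · rintro _ ⟨A, hA, rfl⟩
    exact hcol 1 (by decide) A hA
  · rintro _ ⟨A, hA, rfl⟩
    exact hcol 2 (by decide) A hA
end

section
/- Let R = ℚ[c₁,c₂,d₂]/I be the graded ℚ-algebra with deg c₁ = 1, deg c₂ = deg d₂ = 2, where I is generated by c₁⁴ + 3c₂² − 9c₂d₂ − 3d₂², c₁²c₂ − c₂d₂ − 3d₂², c₁²d₂ − 3d₂², 9c₁c₂² − 14c₁c₂d₂, and 3c₁d₂² − 2c₁c₂d₂. Then R is a 13-dimensional ℚ-vector space, with graded pieces of dimensions 1, 1, 3, 3, 3, 1, 1 in degrees 0 through 6, and the graded piece in degree 7 and higher vanishes. -/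
open MvPolynomial

noncomputable section

/-- `c₁ = X 0`, `c₂ = X 1`, `d₂ = X 2` in `ℚ[c₁,c₂,d₂]`. -/
abbrev c1 : MvPolynomial (Fin 3) ℚ := X 0
abbrev c2 : MvPolynomial (Fin 3) ℚ := X 1
abbrev d2 : MvPolynomial (Fin 3) ℚ := X 2

/-- The ideal of relations in the Chow ring of `Y`. -/
def chowIdeal : Ideal (MvPolynomial (Fin 3) ℚ) :=
  Ideal.span {c1 ^ 4 + 3 * c2 ^ 2 - 9 * c2 * d2 - 3 * d2 ^ 2,
    c1 ^ 2 * c2 - c2 * d2 - 3 * d2 ^ 2,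
    c1 ^ 2 * d2 - 3 * d2 ^ 2,
    9 * c1 * c2 ^ 2 - 14 * c1 * c2 * d2,
    3 * c1 * d2 ^ 2 - 2 * c1 * c2 * d2}

/-- The Chow ring `R = ℚ[c₁,c₂,d₂]/I`. -/
abbrev ChowRing : Type := MvPolynomial (Fin 3) ℚ ⧸ chowIdeal

/-- Weights: `deg c₁ = 1`, `deg c₂ = deg d₂ = 2`. -/
def w : Fin 3 → ℕ := ![1, 2, 2]

/-- The degree-`n` graded piece of the Chow ring: the image of the weighted
homogeneous polynomials of degree `n`. -/
def chowPiece (n : ℕ) : Submodule ℚ ChowRing :=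
  Submodule.map (Ideal.Quotient.mkₐ ℚ chowIdeal).toLinearMap
    (weightedHomogeneousSubmodule ℚ w n)

namespace ChowRing

/-- The class of `c₁ ^ a * c₂ ^ b * d₂ ^ c` in the Chow ring. -/
def mon (a b c : ℕ) : ChowRing := Ideal.Quotient.mk chowIdeal (c1 ^ a * c2 ^ b * d2 ^ c)

lemma mon_mul (a b c p q r : ℕ) :
    mon a b c * mon p q r = mon (a + p) (b + q) (c + r) := by
  simp only [mon, ← map_mul]
  congr 1
  ring

/-- The values of the degree map on monomials of weighted degree `6`, in terms of the
exponents of `c₂` and `d₂`. -/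
def degTable : ℕ → ℕ → ℚ
  | 0, 0 => 57
  | 1, 0 => 27
  | 0, 1 => 18
  | 2, 0 => 14
  | 1, 1 => 9
  | 0, 2 => 6
  | 3, 0 => 9
  | 2, 1 => 5
  | 1, 2 => 3
  | 0, 3 => 2
  | _, _ => 0

/-- The degree of the monomial `c₁ ^ a * c₂ ^ b * d₂ ^ c`. -/
def monDeg (a b c : ℕ) : ℚ := if a + 2 * b + 2 * c = 6 then degTable b c else 0

/-- The degree map on the polynomial ring. -/
def polyDeg : MvPolynomial (Fin 3) ℚ →ₗ[ℚ] ℚ :=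
  (basisMonomials (Fin 3) ℚ).constr ℚ fun s => monDeg (s 0) (s 1) (s 2)

lemma monomial_eq (s : Fin 3 →₀ ℕ) :
    (monomial s (1 : ℚ)) = c1 ^ s 0 * c2 ^ s 1 * d2 ^ s 2 := by
  rw [MvPolynomial.monomial_eq, Finsupp.prod_fintype _ _ (by simp)]
  simp [Fin.prod_univ_three]

lemma polyDeg_mon (a b c : ℕ) : polyDeg (c1 ^ a * c2 ^ b * d2 ^ c) = monDeg a b c := by
  have h := monomial_eq (Finsupp.equivFunOnFinite.symm ![a, b, c])
  simp only [Finsupp.equivFunOnFinite_symm_apply_apply, Matrix.cons_val] at h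
  have hb := (basisMonomials (Fin 3) ℚ).constr_basis ℚ (fun s => monDeg (s 0) (s 1) (s 2))
    (Finsupp.equivFunOnFinite.symm ![a, b, c])
  simp only [coe_basisMonomials] at hb
  rw [h] at hb
  exact hb

lemma mul_polyDeg (r : ℚ) (p : MvPolynomial (Fin 3) ℚ) : r * polyDeg p = polyDeg (C r * p) := by
  rw [← smul_eq_C_mul, map_smul, smul_eq_mul]

lemma polyDeg_mul_eq_zero_of_mon {g : MvPolynomial (Fin 3) ℚ}
    (h : ∀ a b c : ℕ, polyDeg (c1 ^ a * c2 ^ b * d2 ^ c * g) = 0) (p : MvPolynomial (Fin 3) ℚ) :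
    polyDeg (p * g) = 0 := by
  induction p using MvPolynomial.induction_on' with
  | monomial s r =>
    have : monomial s r = r • monomial s (1 : ℚ) := by simp [smul_monomial]
    rw [this, smul_mul_assoc, map_smul, monomial_eq, h, smul_zero]
  | add p q hp hq => rw [add_mul, map_add, hp, hq, add_zero]

lemma monDeg_rel₁ (a b c : ℕ) : monDeg (a + 4) b c + 3 * monDeg a (b + 2) c
    - 9 * monDeg a (b + 1) (c + 1) - 3 * monDeg a b (c + 2) = 0 := by
  by_cases h : a + 2 * b + 2 * c = 2
  · have hb : b ≤ 1 := by omega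
    have hc : c ≤ 1 := by omega
    interval_cases b <;> interval_cases c <;> (try omega) <;>
      (obtain rfl : a = _ := by first | exact (by omega : a = 0) | exact (by omega : a = 2)) <;>
      norm_num [monDeg, degTable]
  · simp only [monDeg]
    repeat rw [if_neg (by omega)]
    norm_num

lemma monDeg_rel₂ (a b c : ℕ) : monDeg (a + 2) (b + 1) c - monDeg a (b + 1) (c + 1)
    - 3 * monDeg a b (c + 2) = 0 := by
  by_cases h : a + 2 * b + 2 * c = 2
  · have hb : b ≤ 1 := by omega
    have hc : c ≤ 1 := by omega
    interval_cases b <;> interval_cases c <;> (try omega) <;>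
      (obtain rfl : a = _ := by first | exact (by omega : a = 0) | exact (by omega : a = 2)) <;>
      norm_num [monDeg, degTable]
  · simp only [monDeg]
    repeat rw [if_neg (by omega)]
    norm_num

lemma monDeg_rel₃ (a b c : ℕ) : monDeg (a + 2) b (c + 1) - 3 * monDeg a b (c + 2) = 0 := by
  by_cases h : a + 2 * b + 2 * c = 2
  · have hb : b ≤ 1 := by omega
    have hc : c ≤ 1 := by omega
    interval_cases b <;> interval_cases c <;> (try omega) <;>
      (obtain rfl : a = _ := by first | exact (by omega : a = 0) | exact (by omega : a = 2)) <;>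
      norm_num [monDeg, degTable]
  · simp only [monDeg]
    repeat rw [if_neg (by omega)]
    norm_num

lemma monDeg_rel₄ (a b c : ℕ) :
    9 * monDeg (a + 1) (b + 2) c - 14 * monDeg (a + 1) (b + 1) (c + 1) = 0 := by
  by_cases h : a + 2 * b + 2 * c = 1
  · obtain ⟨rfl, rfl, rfl⟩ : a = 1 ∧ b = 0 ∧ c = 0 := by omega
    norm_num [monDeg, degTable]
  · simp only [monDeg]
    repeat rw [if_neg (by omega)]
    norm_num

lemma monDeg_rel₅ (a b c : ℕ) :
    3 * monDeg (a + 1) b (c + 2) - 2 * monDeg (a + 1) (b + 1) (c + 1) = 0 := by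
  by_cases h : a + 2 * b + 2 * c = 1
  · obtain ⟨rfl, rfl, rfl⟩ : a = 1 ∧ b = 0 ∧ c = 0 := by omega
    norm_num [monDeg, degTable]
  · simp only [monDeg]
    repeat rw [if_neg (by omega)]
    norm_num

lemma polyDeg_eq_zero {p : MvPolynomial (Fin 3) ℚ} (hp : p ∈ chowIdeal) : polyDeg p = 0 := by
  suffices h : ∀ q, polyDeg (q * p) = 0 by simpa using h 1
  induction hp using Submodule.span_induction with
  | mem g hg =>
    refine polyDeg_mul_eq_zero_of_mon fun a b c => ?_
    rcases hg with rfl | rfl | rfl | rfl | rfl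
    on_goal 1 => rw [← monDeg_rel₁ a b c]
    on_goal 2 => rw [← monDeg_rel₂ a b c]
    on_goal 3 => rw [← monDeg_rel₃ a b c]
    on_goal 4 => rw [← monDeg_rel₄ a b c]
    on_goal 5 => rw [← monDeg_rel₅ a b c]
    all_goals
      simp only [← polyDeg_mon, mul_polyDeg, ← map_add, ← map_sub]
      congr 1
      simp only [map_ofNat]
      ring
  | zero => simp
  | add p q _ _ hp hq => intro r; rw [mul_add, map_add, hp, hq, add_zero]
  | smul r p _ hp => intro q; rw [smul_eq_mul, ← mul_assoc, hp]

/-- The degree map of the Chow ring. -/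
def deg : ChowRing →ₗ[ℚ] ℚ :=
  (chowIdeal.restrictScalars ℚ).liftQ polyDeg fun _ hp => polyDeg_eq_zero hp

lemma deg_mon (a b c : ℕ) : deg (mon a b c) = monDeg a b c := polyDeg_mon a b c

/-- The proposed basis of the Chow ring. -/
def basisElt : Fin 13 → ChowRing :=
  ![mon 0 0 0, mon 1 0 0, mon 2 0 0, mon 0 1 0, mon 0 0 1, mon 3 0 0, mon 1 1 0, mon 1 0 1,
    mon 0 2 0, mon 0 1 1, mon 0 0 2, (2 : ℚ) • mon 1 2 0 - (3 : ℚ) • mon 1 1 1,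
    mon 0 1 2 - mon 0 0 3]

/-- The degrees of the basis elements. -/
def wt : Fin 13 → ℕ := ![0, 1, 2, 2, 2, 3, 3, 3, 4, 4, 4, 5, 6]

lemma sum_univ_thirteen {M : Type*} [AddCommMonoid M] (f : Fin 13 → M) :
    ∑ i, f i = f 0 + f 1 + f 2 + f 3 + f 4 + f 5 + f 6 + f 7 + f 8 + f 9 + f 10 + f 11 + f 12 := by
  iterate 5 rw [Fin.sum_univ_castSucc]
  rw [Fin.sum_univ_eight]
  rfl

lemma linearIndependent_basisElt : LinearIndependent ℚ basisElt := by
  rw [Fintype.linearIndependent_iff]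
  intro g hg
  have key (a b c : ℕ) : deg ((∑ i, g i • basisElt i) * mon a b c) = 0 := by
    rw [hg, zero_mul, map_zero]
  simp only [basisElt, sum_univ_thirteen, Matrix.cons_val, add_mul, sub_mul, smul_mul_assoc,
    mon_mul, map_add, map_sub, map_smul, deg_mon, smul_eq_mul, smul_sub] at key
  have k1 := key 6 0 0
  have k2 := key 5 0 0
  have k3 := key 4 0 0
  have k4 := key 2 1 0
  have k5 := key 0 2 0
  have k6 := key 3 0 0
  have k7 := key 1 1 0
  have k8 := key 1 0 1
  have k9 := key 2 0 0
  have k10 := key 0 1 0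
  have k11 := key 0 0 1
  have k12 := key 1 0 0
  have k13 := key 0 0 0
  norm_num [monDeg, degTable] at k1 k2 k3 k4 k5 k6 k7 k8 k9 k10 k11 k12 k13
  intro i
  clear key
  fin_cases i <;> simp <;> linarith

/-- The span of the basis elements of degree `n`. -/
def basisSpan (n : ℕ) : Submodule ℚ ChowRing := Submodule.span ℚ (Set.image basisElt {i | wt i = n})

lemma finrank_basisSpan (n : ℕ) :
    Module.finrank ℚ (basisSpan n) = Fintype.card {i // wt i = n} := by
  have h := finrank_span_eq_card (linearIndependent_basisElt.comp
    (Subtype.val : {i // wt i = n} → Fin 13) Subtype.val_injective)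
  rwa [Set.range_comp, Subtype.range_coe_subtype] at h

lemma basisElt_mem (i : Fin 13) : basisElt i ∈ basisSpan (wt i) :=
  Submodule.subset_span ⟨i, rfl, rfl⟩

lemma basisSpan_eq_bot {n : ℕ} (hn : 7 ≤ n) : basisSpan n = ⊥ := by
  have : {i | wt i = n} = ∅ := by
    ext i
    have : wt i < 7 := by revert i; decide
    simp only [Set.mem_ofPred_eq, Set.mem_empty_iff_false, iff_false]
    omega
  rw [basisSpan, this, Set.image_empty, Submodule.span_empty]

/-- The class of `c₁`. -/
def x : ChowRing := Ideal.Quotient.mk chowIdeal c1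

/-- The class of `c₂`. -/
def y : ChowRing := Ideal.Quotient.mk chowIdeal c2

/-- The class of `d₂`. -/
def z : ChowRing := Ideal.Quotient.mk chowIdeal d2

/-- The generator in degree `5`. -/
def u : ChowRing := 2 * x * y ^ 2 - 3 * x * y * z

/-- The generator in degree `6`. -/
def v : ChowRing := y * z ^ 2 - z ^ 3

lemma mon_eq (a b c : ℕ) : mon a b c = x ^ a * y ^ b * z ^ c := by
  simp only [mon, x, y, z, map_mul, map_pow]

lemma basisElt_eq :
    basisElt = ![1, x, x ^ 2, y, z, x ^ 3, x * y, x * z, y ^ 2, y * z, z ^ 2, u, v] := by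
  simp only [basisElt, mon_eq, u, v, ofNat_smul_eq_nsmul, nsmul_eq_mul, Nat.cast_ofNat]
  simp [mul_assoc]

lemma rel₁ : x ^ 4 + 3 * y ^ 2 - 9 * y * z - 3 * z ^ 2 = 0 := by
  have : c1 ^ 4 + 3 * c2 ^ 2 - 9 * c2 * d2 - 3 * d2 ^ 2 ∈ chowIdeal :=
    Ideal.subset_span (by simp)
  have h := Ideal.Quotient.eq_zero_iff_mem.2 this
  simp only [map_add, map_sub, map_mul, map_pow, map_ofNat] at h
  exact h

lemma rel₂ : x ^ 2 * y - y * z - 3 * z ^ 2 = 0 := by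
  have : c1 ^ 2 * c2 - c2 * d2 - 3 * d2 ^ 2 ∈ chowIdeal := Ideal.subset_span (by simp)
  have h := Ideal.Quotient.eq_zero_iff_mem.2 this
  simp only [map_sub, map_mul, map_pow, map_ofNat] at h
  exact h

lemma rel₃ : x ^ 2 * z - 3 * z ^ 2 = 0 := by
  have : c1 ^ 2 * d2 - 3 * d2 ^ 2 ∈ chowIdeal := Ideal.subset_span (by simp)
  have h := Ideal.Quotient.eq_zero_iff_mem.2 this
  simp only [map_sub, map_mul, map_pow, map_ofNat] at h
  exact h

lemma rel₄ : 9 * x * y ^ 2 - 14 * x * y * z = 0 := by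
  have : 9 * c1 * c2 ^ 2 - 14 * c1 * c2 * d2 ∈ chowIdeal := Ideal.subset_span (by simp)
  have h := Ideal.Quotient.eq_zero_iff_mem.2 this
  simp only [map_sub, map_mul, map_pow, map_ofNat] at h
  exact h

lemma rel₅ : 3 * x * z ^ 2 - 2 * x * y * z = 0 := by
  have : 3 * c1 * d2 ^ 2 - 2 * c1 * c2 * d2 ∈ chowIdeal := Ideal.subset_span (by simp)
  have h := Ideal.Quotient.eq_zero_iff_mem.2 this
  simp only [map_sub, map_mul, map_pow, map_ofNat] at h
  exact h

lemma three_mul_cancel {a b : ChowRing} (h : 3 * a = 3 * b) : a = b := by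
  have h3 : (3 : ℚ) • a = (3 : ℚ) • b := by
    simpa only [ofNat_smul_eq_nsmul, nsmul_eq_mul, Nat.cast_ofNat] using h
  exact smul_right_injective _ (by norm_num : (3 : ℚ) ≠ 0) h3

lemma x_mul_y_sq : x * y ^ 2 = 14 * u := by
  unfold u; linear_combination -3 * rel₄

lemma x_mul_y_mul_z : x * y * z = 9 * u := by
  unfold u; linear_combination -2 * rel₄

lemma x_mul_z_sq : x * z ^ 2 = 6 * u := by
  apply three_mul_cancel
  unfold u; linear_combination rel₅ - 4 * rel₄

lemma two_y_mul_z_sq : 2 * y * z ^ 2 = 3 * z ^ 3 := by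
  linear_combination z * rel₂ - y * rel₃

lemma z_cube : z ^ 3 = 2 * v := by
  unfold v; linear_combination -two_y_mul_z_sq

lemma y_mul_z_sq : y * z ^ 2 = 3 * v := by
  unfold v; linear_combination -two_y_mul_z_sq

lemma y_sq_mul_z : y ^ 2 * z = 5 * v := by
  apply three_mul_cancel
  apply three_mul_cancel
  linear_combination x * rel₄ - 9 * y * rel₂ + 14 * y * rel₃ + 15 * y_mul_z_sq

lemma y_cube : y ^ 3 = 9 * v := by
  apply three_mul_cancel
  linear_combination y * rel₁ - x ^ 2 * rel₂ - y * rel₃ - 3 * z * rel₃ + 9 * y_sq_mul_z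
    - 9 * z_cube

lemma x_mul_u : x * u = v := by
  unfold u
  linear_combination 2 * y * rel₂ - 3 * y * rel₃ + 2 * y_sq_mul_z - 3 * y_mul_z_sq

lemma z_mul_u : z * u = 0 := by
  linear_combination -2 * z * x_mul_y_sq + 2 * y * x_mul_y_mul_z + 3 * z * x_mul_y_mul_z
    - 3 * y * x_mul_z_sq

lemma y_mul_u : y * u = 0 := by
  apply three_mul_cancel
  linear_combination 5 * z_mul_u + z * x_mul_y_sq - y * x_mul_y_mul_z - z * x_mul_y_mul_z
    + y * x_mul_z_sq

lemma x_mul_v : x * v = 0 := by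
  unfold v
  linear_combination z * x_mul_y_mul_z - z * x_mul_z_sq + 3 * z_mul_u

lemma y_mul_v : y * v = 0 := by
  linear_combination x * y_mul_u - y * x_mul_u

lemma z_mul_v : z * v = 0 := by
  linear_combination x * z_mul_u - z * x_mul_u

lemma mem_basisSpan {r : ChowRing} (a : Fin 13 → ℤ) {n : ℕ}
    (ha : ∀ i, wt i = n ∨ a i = 0) (h : r = ∑ i, a i * basisElt i) : r ∈ basisSpan n := by
  rw [h]
  refine Submodule.sum_mem _ fun i _ => ?_
  rcases ha i with rfl | hi
  · rw [← zsmul_eq_mul]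
    exact zsmul_mem (basisElt_mem i) _
  · simp [hi]

/-- The matrix of multiplication by `c₁`. -/
def mulX : Fin 13 → Fin 13 → ℤ :=
  ![Pi.single 1 1, Pi.single 2 1, Pi.single 5 1, Pi.single 6 1, Pi.single 7 1,
    ![0, 0, 0, 0, 0, 0, 0, 0, -3, 9, 3, 0, 0], ![0, 0, 0, 0, 0, 0, 0, 0, 0, 1, 3, 0, 0],
    Pi.single 10 3, Pi.single 11 14, Pi.single 11 9, Pi.single 11 6, Pi.single 12 1, 0]

/-- The matrix of multiplication by `c₂`. -/
def mulY : Fin 13 → Fin 13 → ℤ :=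
  ![Pi.single 3 1, Pi.single 6 1, ![0, 0, 0, 0, 0, 0, 0, 0, 0, 1, 3, 0, 0], Pi.single 8 1,
    Pi.single 9 1, Pi.single 11 27, Pi.single 11 14, Pi.single 11 9, Pi.single 12 9,
    Pi.single 12 5, Pi.single 12 3, 0, 0]

/-- The matrix of multiplication by `d₂`. -/
def mulZ : Fin 13 → Fin 13 → ℤ :=
  ![Pi.single 4 1, Pi.single 7 1, Pi.single 10 3, Pi.single 9 1, Pi.single 10 1,
    Pi.single 11 18, Pi.single 11 9, Pi.single 11 6, Pi.single 12 5, Pi.single 12 3,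
    Pi.single 12 2, 0, 0]

lemma x_mul_basisElt (i : Fin 13) : x * basisElt i = ∑ j, mulX i j * basisElt j := by
  rw [basisElt_eq]
  fin_cases i <;> simp [mulX, sum_univ_thirteen, Pi.single_apply]
  · ring
  · ring
  · linear_combination rel₁
  · linear_combination rel₂
  · linear_combination rel₃
  · exact x_mul_y_sq
  · linear_combination x_mul_y_mul_z
  · exact x_mul_z_sq
  · exact x_mul_u
  · exact x_mul_v

lemma y_mul_basisElt (i : Fin 13) : y * basisElt i = ∑ j, mulY i j * basisElt j := by
  rw [basisElt_eq]
  fin_cases i <;> simp [mulY, sum_univ_thirteen, Pi.single_apply]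
  · ring
  · linear_combination rel₂
  · ring
  · linear_combination x * rel₂ + x_mul_y_mul_z + 3 * x_mul_z_sq
  · linear_combination x_mul_y_sq
  · linear_combination x_mul_y_mul_z
  · linear_combination y_cube
  · linear_combination y_sq_mul_z
  · exact y_mul_z_sq
  · exact y_mul_u
  · exact y_mul_v

lemma z_mul_basisElt (i : Fin 13) : z * basisElt i = ∑ j, mulZ i j * basisElt j := by
  rw [basisElt_eq]
  fin_cases i <;> simp [mulZ, Pi.single_apply]
  · ring
  · linear_combination rel₃
  · ring
  · ring
  · linear_combination x * rel₃ + 3 * x_mul_z_sq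
  · linear_combination x_mul_y_mul_z
  · linear_combination x_mul_z_sq
  · linear_combination y_sq_mul_z
  · linear_combination y_mul_z_sq
  · linear_combination z_cube
  · exact z_mul_u
  · exact z_mul_v

lemma mul_mem_basisSpan {t : ChowRing} {k : ℕ} (ht : ∀ i, t * basisElt i ∈ basisSpan (wt i + k))
    {n : ℕ} {r : ChowRing} (hr : r ∈ basisSpan n) : t * r ∈ basisSpan (n + k) := by
  induction hr using Submodule.span_induction with
  | mem r hr =>
    obtain ⟨i, rfl, rfl⟩ := hr
    exact ht i
  | zero => simp
  | add r s _ _ hr hs => rw [mul_add]; exact add_mem hr hs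
  | smul q r _ hr => rw [mul_smul_comm]; exact Submodule.smul_mem _ _ hr

lemma x_mul_mem {n : ℕ} {r : ChowRing} (hr : r ∈ basisSpan n) : x * r ∈ basisSpan (n + 1) :=
  mul_mem_basisSpan (fun i => mem_basisSpan (mulX i) (by revert i; decide) (x_mul_basisElt i)) hr

lemma y_mul_mem {n : ℕ} {r : ChowRing} (hr : r ∈ basisSpan n) : y * r ∈ basisSpan (n + 2) :=
  mul_mem_basisSpan (fun i => mem_basisSpan (mulY i) (by revert i; decide) (y_mul_basisElt i)) hr

lemma z_mul_mem {n : ℕ} {r : ChowRing} (hr : r ∈ basisSpan n) : z * r ∈ basisSpan (n + 2) :=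
  mul_mem_basisSpan (fun i => mem_basisSpan (mulZ i) (by revert i; decide) (z_mul_basisElt i)) hr

lemma mon_mem (a b c : ℕ) : mon a b c ∈ basisSpan (a + 2 * b + 2 * c) := by
  rw [mon_eq]
  induction a with
  | zero =>
    induction b with
    | zero =>
      induction c with
      | zero => simpa [basisElt_eq, wt] using basisElt_mem 0
      | succ c ih => convert z_mul_mem ih using 1 <;> ring_nf
    | succ b ih => convert y_mul_mem ih using 1 <;> ring_nf
  | succ a ih => convert x_mul_mem ih using 1 <;> ring_nf

lemma weight_w (s : Fin 3 →₀ ℕ) : Finsupp.weight w s = s 0 + 2 * s 1 + 2 * s 2 := by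
  simp [Finsupp.weight_apply, Finsupp.sum_fintype, Fin.sum_univ_three, w, mul_comm]

lemma mk_eq_sum (p : MvPolynomial (Fin 3) ℚ) :
    Ideal.Quotient.mk chowIdeal p = ∑ s ∈ p.support, p.coeff s • mon (s 0) (s 1) (s 2) := by
  conv_lhs => rw [p.as_sum]
  rw [map_sum]
  refine Finset.sum_congr rfl fun s _ => ?_
  have : monomial s (p.coeff s) = p.coeff s • monomial s (1 : ℚ) := by simp [smul_monomial]
  rw [this, monomial_eq]
  rfl

lemma mon_mem_chowPiece {a b c n : ℕ} (h : a + 2 * b + 2 * c = n) :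
    mon a b c ∈ chowPiece n := by
  refine ⟨c1 ^ a * c2 ^ b * d2 ^ c, ?_, rfl⟩
  have h1 := ((isWeightedHomogeneous_X ℚ w 0).pow a).mul ((isWeightedHomogeneous_X ℚ w 1).pow b)
  have h2 := h1.mul ((isWeightedHomogeneous_X ℚ w 2).pow c)
  convert h2 using 1
  rw [← h]
  simp [w, mul_comm]

lemma chowPiece_eq_basisSpan (n : ℕ) : chowPiece n = basisSpan n := by
  apply le_antisymm
  · rintro _ ⟨p, hp, rfl⟩
    change Ideal.Quotient.mk chowIdeal p ∈ _
    rw [mk_eq_sum]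
    refine Submodule.sum_mem _ fun s hs => Submodule.smul_mem _ _ ?_
    rw [← hp (mem_support_iff.1 hs), weight_w]
    exact mon_mem _ _ _
  · refine Submodule.span_le.2 ?_
    rintro _ ⟨i, rfl, rfl⟩
    fin_cases i
    on_goal 12 =>
      exact (chowPiece 5).sub_mem (Submodule.smul_mem _ _ (mon_mem_chowPiece rfl))
        (Submodule.smul_mem _ _ (mon_mem_chowPiece rfl))
    on_goal 12 =>
      exact (chowPiece 6).sub_mem (mon_mem_chowPiece rfl) (mon_mem_chowPiece rfl)
    all_goals exact mon_mem_chowPiece rfl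

lemma span_range_basisElt : Submodule.span ℚ (Set.range basisElt) = ⊤ := by
  refine eq_top_iff.2 fun r _ => ?_
  obtain ⟨p, rfl⟩ := Ideal.Quotient.mk_surjective r
  rw [mk_eq_sum]
  exact Submodule.sum_mem _ fun s _ => Submodule.smul_mem _ _
    (Submodule.span_mono (Set.image_subset_range _ _) (mon_mem _ _ _))

end ChowRing

/-- `R` is 13-dimensional, with graded pieces of dimensions 1,1,3,3,3,1,1 in
degrees 0–6 and zero in degrees ≥ 7. -/
theorem chowRing_dims :
    Module.finrank ℚ ChowRing = 13 ∧
    Module.finrank ℚ (chowPiece 0) = 1 ∧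
    Module.finrank ℚ (chowPiece 1) = 1 ∧
    Module.finrank ℚ (chowPiece 2) = 3 ∧
    Module.finrank ℚ (chowPiece 3) = 3 ∧
    Module.finrank ℚ (chowPiece 4) = 3 ∧
    Module.finrank ℚ (chowPiece 5) = 1 ∧
    Module.finrank ℚ (chowPiece 6) = 1 ∧
    ∀ n : ℕ, 7 ≤ n → chowPiece n = ⊥ := by
  have h13 := finrank_span_eq_card ChowRing.linearIndependent_basisElt
  rw [ChowRing.span_range_basisElt, finrank_top] at h13
  have hn (n : ℕ) : Module.finrank ℚ (chowPiece n) = Fintype.card {i // ChowRing.wt i = n} := by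
    rw [ChowRing.chowPiece_eq_basisSpan, ChowRing.finrank_basisSpan]
  exact ⟨h13, hn 0, hn 1, hn 2, hn 3, hn 4, hn 5, hn 6,
    fun n h => (ChowRing.chowPiece_eq_basisSpan n).trans (ChowRing.basisSpan_eq_bot h)⟩

end
end

section
/- Let Q₁ = ℂ[c₁,c₂,d₂]/J₁ where J₁ is generated by the q = 1 specializations of the quantum relations: c₁⁴ − 11c₁ + 3c₂² − 9c₂d₂ − 3d₂², c₁²c₂ − 3c₁ − c₂d₂ − 3d₂², c₁²d₂ − 2c₁ − 3d₂², 9(c₁c₂² − 4c₁² + 3c₂ + d₂) − 14(c₁c₂d₂ − 3c₁² + c₂ + 3d₂), and 2(c₁c₂d₂ − 3c₁² + c₂ + 3d₂) − 3(c₁d₂² − 2c₁² + 3d₂). Then Q₁ is a 13-dimensional ℂ-vector space and is a reduced ring. -/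
open MvPolynomial

noncomputable section

abbrev qc1 : MvPolynomial (Fin 3) ℂ := X 0
abbrev qc2 : MvPolynomial (Fin 3) ℂ := X 1
abbrev qd2 : MvPolynomial (Fin 3) ℂ := X 2

/-- The ideal of the `q = 1` specializations of the quantum relations. -/
def quantumIdeal : Ideal (MvPolynomial (Fin 3) ℂ) :=
  Ideal.span {qc1 ^ 4 - 11 * qc1 + 3 * qc2 ^ 2 - 9 * qc2 * qd2 - 3 * qd2 ^ 2,
    qc1 ^ 2 * qc2 - 3 * qc1 - qc2 * qd2 - 3 * qd2 ^ 2,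
    qc1 ^ 2 * qd2 - 2 * qc1 - 3 * qd2 ^ 2,
    9 * (qc1 * qc2 ^ 2 - 4 * qc1 ^ 2 + 3 * qc2 + qd2)
      - 14 * (qc1 * qc2 * qd2 - 3 * qc1 ^ 2 + qc2 + 3 * qd2),
    2 * (qc1 * qc2 * qd2 - 3 * qc1 ^ 2 + qc2 + 3 * qd2)
      - 3 * (qc1 * qd2 ^ 2 - 2 * qc1 ^ 2 + 3 * qd2)}

/-- `Q₁ = ℂ[c₁,c₂,d₂]/J₁`: the `q = 1` specialization of the small quantum
cohomology ring of `Y`. -/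
abbrev QuantumRing : Type := MvPolynomial (Fin 3) ℂ ⧸ quantumIdeal

section

variable {R : Type*} [CommRing R]

/-- The `q = 1` quantum relations, imposed on elements of an arbitrary commutative ring. -/
structure QuantumRelations (x y z : R) : Prop where
  rel₁ : x ^ 4 - 11 * x + 3 * y ^ 2 - 9 * y * z - 3 * z ^ 2 = 0
  rel₂ : x ^ 2 * y - 3 * x - y * z - 3 * z ^ 2 = 0
  rel₃ : x ^ 2 * z - 2 * x - 3 * z ^ 2 = 0
  rel₄ : 9 * (x * y ^ 2 - 4 * x ^ 2 + 3 * y + z) - 14 * (x * y * z - 3 * x ^ 2 + y + 3 * z) = 0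
  rel₅ : 2 * (x * y * z - 3 * x ^ 2 + y + 3 * z) - 3 * (x * z ^ 2 - 2 * x ^ 2 + 3 * z) = 0

/-- The characteristic polynomial of multiplication by `c₂`. -/
def charPolyC2 (y : R) : R :=
  y ^ 13 - 135 * y ^ 10 + 2214 * y ^ 7 - 3645 * y ^ 4 + 59049 * y

/-- `18567630 * c₁` as a polynomial in `c₂`. -/
def scaledC1 (y : R) : R :=
  481 * y ^ 11 - 64314 * y ^ 8 + 1044522 * y ^ 5 - 4831083 * y ^ 2

/-- `18567630 * d₂` as a polynomial in `c₂`. -/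
def scaledD2 (y : R) : R :=
  -513 * y ^ 10 + 68688 * y ^ 7 - 1045386 * y ^ 4 + 11138391 * y

variable [Algebra ℂ R]

theorem eq_zero_of_algebraMap_mul {c : ℂ} (hc : c ≠ 0) {a : R}
    (h : algebraMap ℂ R c * a = 0) : a = 0 := by
  rw [← Algebra.smul_def] at h
  exact (smul_eq_zero_iff_right hc).mp h

/-- The quantum relations determine `c₁` and `d₂` in terms of `c₂`. -/
theorem QuantumRelations.elimination {x y z : R} (h : QuantumRelations x y z) :
    charPolyC2 y = 0 ∧ 18567630 * x = scaledC1 y ∧ 18567630 * z = scaledD2 y := by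
  obtain ⟨h1, h2, h3, h4, h5⟩ := h
  have p2 : 3 * y ^ 2 = 9 * x ^ 2 * y - 8 * x ^ 2 * z - x ^ 4 := by
    linear_combination h1 + (-9) * h2 + (8) * h3
  have p3 : 57 * y ^ 3 = 9 * x ^ 6 - 342 * x * y + 810 * x * z - 288 * x ^ 3 := by
    linear_combination 19 * y * p2 + (66 * z - 9 * x ^ 2) * h1 + (198 * y + 216 * z - 19 * x ^ 2)
      * h2 + (-468 * y - 282 * z - 66 * x ^ 2) * h3
  have p4 : 57 * y ^ 4 = 24 * x ^ 5 + 513 * y - 3483 * z + 2481 * x ^ 2 := by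
    linear_combination y * p3 + (243 * z ^ 2 - 243 * x ^ 2 * z + 489 * x) * h1 + (729 * y * z -
      4374 * z ^ 2 + 1107 * x ^ 2 * z + 9 * x ^ 4 - 2484 * x) * h2 + (4131 * z ^ 2 - 1098 * x ^ 2
      * y + 513 * x ^ 2 * z + 243 * x ^ 4 + 1674 * x) * h3 + (-201) * h4 + (1050) * h5
  have p5 : 57 * y ^ 5 = 513 * x ^ 2 * y - 1197 * x ^ 2 * z + 1197 * x ^ 4 + 1539 * x := by
    linear_combination y * p4 + (-648 * x * z + 171) * h1 + (-1368 * x * z + 24 * x ^ 3 + 4752) *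
      h2 + (1392 * x * y + 2016 * x * z + 648 * x ^ 3 - 7299) * h3 + (216 * z) * h4
  have p6 : 57 * y ^ 6 = 504 * x ^ 6 + 5346 * x * z - 3303 * x ^ 3 := by
    linear_combination y * p5 + (675 * z - 504 * x ^ 2) * h1 + (2025 * y - 729 * z + 1197 * x ^ 2)
      * h2 + (-3807 * y + 54 * z - 675 * x ^ 2) * h3
  have p7 : 57 * y ^ 7 = 5805 * x ^ 5 - 1539 * y - 100845 * z + 106650 * x ^ 2 := by
    linear_combination y * p6 + (13608 * z ^ 2 - 13608 * x ^ 2 * z + 22923 * x) * h1 + (40824 * y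
      * z - 244944 * z ^ 2 + 61992 * x ^ 2 * z + 504 * x ^ 4 - 126279 * x) * h2 + (231336 * z ^ 2
      - 61488 * x ^ 2 * y + 28728 * x ^ 2 * z + 13608 * x ^ 4 + 93744 * x) * h3 + (-7641) * h4 +
      (50436) * h5
  have p8 : 57 * y ^ 8 = -4617 * x ^ 2 * y - 696141 * x ^ 2 * z + 331398 * x ^ 4 - 369360 * x :=
    by
    linear_combination y * p7 + (-156735 * x * z - 513) * h1 + (-330885 * x * z + 5805 * x ^ 3 +
      784647) * h2 + (336690 * x * y + 487620 * x * z + 156735 * x ^ 3 - 1358829) * h3 + (52245 *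
      z) * h4
  have p9 : 57 * y ^ 9 = 45927 * x ^ 6 + 9234 * x * y - 368145 * x * z + 400221 * x ^ 3 := by
    linear_combination y * p8 + (44388 * z - 45927 * x ^ 2) * h1 + (133164 * y - 767637 * z +
      331398 * x ^ 2) * h2 + (-10449 * y + 723249 * z - 44388 * x ^ 2) * h3
  have p10 : 57 * y ^ 10 = 728352 * x ^ 5 - 13851 * y - 8468064 * z + 9224118 * x ^ 2 := by
    linear_combination y * p9 + (1240029 * z ^ 2 - 1240029 * x ^ 2 * z + 1889487 * x) * h1 +
      (3720087 * y * z - 22320522 * z ^ 2 + 5649021 * x ^ 2 * z + 45927 * x ^ 4 - 10805967 * x) *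
      h2 + (21080493 * z ^ 2 - 5603094 * x ^ 2 * y + 2617839 * x ^ 2 * z + 1240029 * x ^ 4 +
      8542422 * x) * h3 + (-628803) * h4 + (4094145) * h5
  have p11 : 57 * y ^ 11 = -13851 * x ^ 2 * y - 92007576 * x ^ 2 * z + 41520681 * x ^ 4 - 50528448
    * x := by
    linear_combination y * p10 + (-19665504 * x * z - 4617) * h1 + (-41516064 * x * z + 728352 * x
      ^ 3 + 93726801) * h2 + (42244416 * x * y + 61181568 * x * z + 19665504 * x ^ 3 - 165829032)
      * h3 + (6555168 * z) * h4
  have p12 : 57 * y ^ 12 = 5136777 * x ^ 6 - 52697952 * x * z + 57793176 * x ^ 3 := by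
    linear_combination y * p11 + (5132160 * z - 5136777 * x ^ 2) * h1 + (15396480 * y - 98887392 *
      z + 41520681 * x ^ 2) * h2 + (2169504 * y + 93755232 * z - 5132160 * x ^ 2) * h3
  have p13 : 57 * y ^ 13 = 85562730 * x ^ 5 + 41553 * y - 932613345 * z + 1018176075 * x ^ 2 := by
    linear_combination y * p12 + (138692979 * z ^ 2 - 138692979 * x ^ 2 * z + 207233559 * x) * h1
      + (416078937 * y * z - 2496473622 * z ^ 2 + 631823571 * x ^ 2 * z + 5136777 * x ^ 4 -
      1195580412 * x) * h2 + (2357780643 * z ^ 2 - 626686794 * x ^ 2 * y + 292796289 * x ^ 2 * z +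
      138692979 * x ^ 4 + 955440522 * x) * h3 + (-69077853) * h4 + (448985268) * h5
  refine ⟨eq_zero_of_algebraMap_mul (c := 57) (by norm_num) ?_,
    sub_eq_zero.mp (eq_zero_of_algebraMap_mul (c := 57) (by norm_num) ?_),
    sub_eq_zero.mp (eq_zero_of_algebraMap_mul (c := 19) (by norm_num) ?_)⟩
  · rw [map_ofNat, charPolyC2]
    linear_combination p13 + (-135) * p10 + (2214) * p7 + (-3645) * p4
  · rw [map_ofNat, scaledC1]
    linear_combination (91790577) * p2 + (-1044522) * p5 + (64314) * p8 + (-481) * p11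
  · rw [map_ofNat, scaledD2]
    linear_combination (348462) * p4 + (-22896) * p7 + (171) * p10

/-- A root of the characteristic polynomial of `c₂` yields a solution of the quantum relations. -/
theorem QuantumRelations.of_charPolyC2 {x y z : R} (hy : charPolyC2 y = 0)
    (hx : 18567630 * x = scaledC1 y) (hz : 18567630 * z = scaledD2 y) :
    QuantumRelations x y z := by
  rw [charPolyC2] at hy
  have cancel (k : ℕ) {a : R} (ha : 18567630 ^ k * a = 0) : a = 0 :=
    eq_zero_of_algebraMap_mul (c := 18567630 ^ k) (pow_ne_zero k (by norm_num))
      (by rwa [map_pow, map_ofNat])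
  constructor
  · refine cancel 4 ?_
    trans (18567630 * x) ^ 4 - 11 * 18567630 ^ 3 * (18567630 * x) + 3 * 18567630 ^ 4 * y ^ 2 - 9 *
      18567630 ^ 3 * y * (18567630 * z) - 3 * 18567630 ^ 2 * (18567630 * z) ^ 2
    · ring
    · rw [hx, hz, scaledC1, scaledD2]
      linear_combination (53527912321 * y ^ 31 - 21402373441761 * y ^ 28 + 3198983782116915 * y ^
        25 - 221039619332886900 * y ^ 22 + 7419595371156455724 * y ^ 19 - 141871167987963863868 *
        y ^ 16 + 1614791775764460027483 * y ^ 13 - 10529468947794425302899 * y ^ 10 +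
        26005737677252927867829 * y ^ 7 + 105680102749589130218100 * y ^ 4 -
        1240812648166668041796300 * y) * hy
  · refine cancel 3 ?_
    trans 18567630 * (18567630 * x) ^ 2 * y - 3 * 18567630 ^ 2 * (18567630 * x) - 18567630 ^ 2 * y
      * (18567630 * z) - 3 * 18567630 * (18567630 * z) ^ 2
    · ring
    · rw [hx, hz, scaledC1, scaledD2]
      linear_combination (4295825444430 * y ^ 10 - 583503369559200 * y ^ 7 + 11100114863675100 * y
        ^ 4 - 97446176161454610 * y) * hy
  · refine cancel 3 ?_
    trans (18567630 * x) ^ 2 * (18567630 * z) - 2 * 18567630 ^ 2 * (18567630 * x) - 3 * 18567630 *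
      (18567630 * z) ^ 2
    · ring
    · rw [hx, hz, scaledC1, scaledD2]
      linear_combination (-118688193 * y ^ 19 + 31608163197 * y ^ 16 - 2599110040113 * y ^ 13 +
        70403616192987 * y ^ 10 - 1123379488562769 * y ^ 7 + 10431789738997221 * y ^ 4 -
        60621033460419810 * y) * hy
  · refine cancel 3 ?_
    trans 9 * (18567630 ^ 2 * (18567630 * x) * y ^ 2 - 4 * 18567630 * (18567630 * x) ^ 2 + 3 *
      18567630 ^ 3 * y + 18567630 ^ 2 * (18567630 * z)) - 14 * (18567630 * (18567630 * x) * y *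
      (18567630 * z) - 3 * 18567630 * (18567630 * x) ^ 2 + 18567630 ^ 3 * y + 3 * 18567630 ^ 2 *
      (18567630 * z))
    · ring
    · rw [hx, hz, scaledC1, scaledD2]
      linear_combination (89917610342040 * y ^ 9 - 11918616805725840 * y ^ 6 + 182999871647388720
        * y ^ 3 - 736745460716715300) * hy
  · refine cancel 3 ?_
    trans 2 * (18567630 * (18567630 * x) * y * (18567630 * z) - 3 * 18567630 * (18567630 * x) ^ 2
      + 18567630 ^ 3 * y + 3 * 18567630 ^ 2 * (18567630 * z)) - 3 * ((18567630 * x) * (18567630 *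
      z) ^ 2 - 2 * 18567630 * (18567630 * x) ^ 2 + 3 * 18567630 ^ 2 * (18567630 * z))
    · ring
    · rw [hx, hz, scaledC1, scaledD2]
      linear_combination (-379752867 * y ^ 18 + 101203536537 * y ^ 15 - 8274626498457 * y ^ 12 +
        213934664170827 * y ^ 9 - 2820498357571101 * y ^ 6 + 16261081418893761 * y ^ 3 +
        21719683680464700) * hy

end

/-- The characteristic polynomial of `c₂`, as a polynomial over `ℂ`. -/
abbrev c2Poly : Polynomial ℂ := charPolyC2 Polynomial.X

theorem c2Poly_eq : c2Poly = Polynomial.X ^ 13 - 135 * Polynomial.X ^ 10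
    + 2214 * Polynomial.X ^ 7 - 3645 * Polynomial.X ^ 4 + 59049 * Polynomial.X := rfl

theorem aeval_c2Poly {R : Type*} [CommRing R] [Algebra ℂ R] (y : R) :
    Polynomial.aeval y c2Poly = charPolyC2 y := by
  simp [charPolyC2, map_ofNat]

theorem natDegree_c2Poly : c2Poly.natDegree = 13 := by
  rw [c2Poly_eq]
  compute_degree!

theorem c2Poly_ne_zero : c2Poly ≠ 0 :=
  Polynomial.ne_zero_of_natDegree_gt (n := 0) (by simp [natDegree_c2Poly])

theorem separable_c2Poly : c2Poly.Separable := by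
  have hd : Polynomial.derivative c2Poly = 13 * Polynomial.X ^ 12 - 1350 * Polynomial.X ^ 9
      + 15498 * Polynomial.X ^ 6 - 14580 * Polynomial.X ^ 3 + 59049 := by
    rw [c2Poly_eq]
    simp [map_ofNat]
    ring
  have hC : Polynomial.C (544543497988793550⁻¹ : ℂ) * 544543497988793550 = 1 := by
    rw [← map_ofNat (Polynomial.C : ℂ →+* _), ← map_mul, inv_mul_cancel₀ (by norm_num), map_one]
  refine ⟨Polynomial.C 544543497988793550⁻¹ *
      (-2289003977 * Polynomial.X ^ 11 + 238571324622 * Polynomial.X ^ 8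
        - 2813743738593 * Polynomial.X ^ 5 + 3008595401748 * Polynomial.X ^ 2),
    Polynomial.C 544543497988793550⁻¹ *
      (176077229 * Polynomial.X ^ 12 - 23837123259 * Polynomial.X ^ 9
        + 398443544073 * Polynomial.X ^ 6 - 731585042748 * Polynomial.X ^ 3 + 9221891953950), ?_⟩
  rw [hd, c2Poly_eq]
  linear_combination hC

section

variable {R : Type*} [CommRing R] [Algebra ℂ R]

theorem charPolyC2_root : charPolyC2 (AdjoinRoot.root c2Poly) = 0 := by
  rw [← aeval_c2Poly, AdjoinRoot.aeval_eq, AdjoinRoot.mk_self]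

/-- `c₁` recovered from `c₂`. -/
def c1OfC2 (y : R) : R := (18567630⁻¹ : ℂ) • scaledC1 y

/-- `d₂` recovered from `c₂`. -/
def d2OfC2 (y : R) : R := (18567630⁻¹ : ℂ) • scaledD2 y

theorem eq_inv_smul {a b : R} : a = (18567630⁻¹ : ℂ) • b ↔ 18567630 * a = b := by
  rw [eq_inv_smul_iff₀ (by norm_num), Algebra.smul_def, map_ofNat]

theorem quantumRelations_of_root {y : R} (hy : charPolyC2 y = 0) :
    QuantumRelations (c1OfC2 y) y (d2OfC2 y) :=
  .of_charPolyC2 hy (eq_inv_smul.mp rfl) (eq_inv_smul.mp rfl)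

theorem map_c1OfC2 {S : Type*} [CommRing S] [Algebra ℂ S] (φ : R →ₐ[ℂ] S) (y : R) :
    φ (c1OfC2 y) = c1OfC2 (φ y) := by
  simp [c1OfC2, scaledC1, map_ofNat]

theorem map_d2OfC2 {S : Type*} [CommRing S] [Algebra ℂ S] (φ : R →ₐ[ℂ] S) (y : R) :
    φ (d2OfC2 y) = d2OfC2 (φ y) := by
  simp [d2OfC2, scaledD2, map_ofNat]

theorem aeval_eq_zero_of_mem_quantumIdeal {x y z : R} (h : QuantumRelations x y z) :
    ∀ p ∈ quantumIdeal, aeval (R := ℂ) ![x, y, z] p = 0 := by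
  suffices quantumIdeal ≤ RingHom.ker (aeval (R := ℂ) ![x, y, z]) from fun p hp ↦ this hp
  refine Ideal.span_le.mpr ?_
  obtain ⟨h1, h2, h3, h4, h5⟩ := h
  rintro p (rfl | rfl | rfl | rfl | rfl) <;> simpa

end

theorem quantumRelations_mk : QuantumRelations (Ideal.Quotient.mk quantumIdeal qc1)
    (Ideal.Quotient.mk quantumIdeal qc2) (Ideal.Quotient.mk quantumIdeal qd2) := by
  constructor <;>
  · simp only [← map_ofNat (Ideal.Quotient.mk quantumIdeal), ← map_pow, ← map_mul, ← map_add,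
      ← map_sub]
    exact Ideal.Quotient.eq_zero_iff_mem.mpr (Ideal.subset_span (by simp))

/-- The map `Q₁ → ℂ[t]/(f)` sending `c₂` to `t`, for `f` the characteristic polynomial of `c₂`. -/
def toAdjoinRoot : QuantumRing →ₐ[ℂ] AdjoinRoot c2Poly :=
  Ideal.Quotient.liftₐ quantumIdeal
    (aeval ![c1OfC2 (AdjoinRoot.root c2Poly), AdjoinRoot.root c2Poly,
      d2OfC2 (AdjoinRoot.root c2Poly)])
    (aeval_eq_zero_of_mem_quantumIdeal (quantumRelations_of_root charPolyC2_root))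

theorem toAdjoinRoot_mk_X (i : Fin 3) :
    toAdjoinRoot (Ideal.Quotient.mk quantumIdeal (X i)) =
      ![c1OfC2 (AdjoinRoot.root c2Poly), AdjoinRoot.root c2Poly,
        d2OfC2 (AdjoinRoot.root c2Poly)] i :=
  aeval_X _ i

/-- The map `ℂ[t]/(f) → Q₁` sending `t` to `c₂`. -/
def ofAdjoinRoot : AdjoinRoot c2Poly →ₐ[ℂ] QuantumRing :=
  AdjoinRoot.liftAlgHom c2Poly (Algebra.ofId ℂ QuantumRing) (Ideal.Quotient.mk quantumIdeal qc2)
    ((aeval_c2Poly _).trans quantumRelations_mk.elimination.1)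

theorem ofAdjoinRoot_root :
    ofAdjoinRoot (AdjoinRoot.root c2Poly) = Ideal.Quotient.mk quantumIdeal qc2 :=
  AdjoinRoot.liftAlgHom_root ..

/-- `c₂` generates `Q₁`, which is therefore `ℂ[t]` modulo the characteristic polynomial of `c₂`. -/
def quantumRingEquiv : QuantumRing ≃ₐ[ℂ] AdjoinRoot c2Poly :=
  AlgEquiv.ofAlgHom toAdjoinRoot ofAdjoinRoot
    (by
      apply AdjoinRoot.algHom_ext
      rw [AlgHom.comp_apply, ofAdjoinRoot_root, toAdjoinRoot_mk_X]
      rfl)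
    (by
      obtain ⟨-, hx, hz⟩ := quantumRelations_mk.elimination
      apply Ideal.Quotient.algHom_ext
      apply MvPolynomial.algHom_ext
      intro i
      change ofAdjoinRoot (toAdjoinRoot (Ideal.Quotient.mk quantumIdeal (X i))) =
        Ideal.Quotient.mk quantumIdeal (X i)
      rw [toAdjoinRoot_mk_X]
      fin_cases i
      · exact (map_c1OfC2 _ _).trans (ofAdjoinRoot_root ▸ (eq_inv_smul.mpr hx).symm)
      · exact ofAdjoinRoot_root
      · exact (map_d2OfC2 _ _).trans (ofAdjoinRoot_root ▸ (eq_inv_smul.mpr hz).symm))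

/-- `Q₁` is a 13-dimensional ℂ-vector space and is reduced. -/
theorem quantumRing_reduced :
    Module.finrank ℂ QuantumRing = 13 ∧ IsReduced QuantumRing := by
  constructor
  · rw [quantumRingEquiv.toLinearEquiv.finrank_eq,
      (AdjoinRoot.powerBasis c2Poly_ne_zero).finrank, AdjoinRoot.powerBasis_dim, natDegree_c2Poly]
  · have : IsReduced (AdjoinRoot c2Poly) :=
      (Ideal.isRadical_iff_quotient_reduced _).mp
        (isRadical_iff_span_singleton.mp separable_c2Poly.squarefree.isRadical)
    exact isReduced_of_injective quantumRingEquiv quantumRingEquiv.injective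

end
end
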